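/- arXiv:1011.3546 — 2 statements merged into one kernel-verified Lean document; each statement's English description precedes it below -/
import Mathlib

section
/- Let M be a metric space and let φ be a continuous flow on M which is expansive. Then for every ε > 0 there exists δ > 0 such that the following holds: for all p, q ∈ M and all π > 0, π' > 0 with φ_π(p) = p and φ_{π'}(q) = q, if d(φ_t(p), φ_{(π'/π)t}(q)) ≤ δ for all t ∈ [0, π], then there exists s with |s| ≤ ε such that q = φ_s(p). -/
/-- `φ` is a continuous flow on `M`. -/
def IsFlow {M : Type*} [TopologicalSpace M] (φ : ℝ → M → M) : Prop :=
  Continuous (fun p : ℝ × M => φ p.1 p.2) ∧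
  (∀ x, φ 0 x = x) ∧
  (∀ s t x, φ (s + t) x = φ s (φ t x))

/-- The flow `φ` is expansive. -/
def IsExpansive {M : Type*} [MetricSpace M] (φ : ℝ → M → M) : Prop :=
  ∀ ε > 0, ∃ δ > 0, ∀ x y : M, ∀ α : ℝ → ℝ, Continuous α → α 0 = 0 →
    (∀ t : ℝ, dist (φ t x) (φ (α t) y) ≤ δ) →
    ∃ s : ℝ, |s| ≤ ε ∧ y = φ s x

/-- Along a flow, the orbit map of a point fixed at time `T` is `T`-periodic. -/
theorem IsFlow.periodic_orbit {M : Type*} [TopologicalSpace M] {φ : ℝ → M → M}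
    (hφ : IsFlow φ) {T : ℝ} {x : M} (hx : φ T x = x) :
    Function.Periodic (fun t => φ t x) T := fun t => by
  simp only [hφ.2.2 t T x, hx]

/-- For an expansive flow, two closed orbits whose linearly reparametrized orbits stay
`δ`-close over one period must coincide (up to a small time shift). -/
theorem expansive_periodic_orbits_close
    {M : Type*} [MetricSpace M] (φ : ℝ → M → M) (hφ : IsFlow φ)
    (hexp : IsExpansive φ) :
    ∀ ε > 0, ∃ δ > 0, ∀ p q : M, ∀ π π' : ℝ, 0 < π → 0 < π' →
      φ π p = p → φ π' q = q →
      (∀ t ∈ Set.Icc (0 : ℝ) π, dist (φ t p) (φ ((π' / π) * t) q) ≤ δ) →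
      ∃ s : ℝ, |s| ≤ ε ∧ q = φ s p := by
  intro ε hε
  obtain ⟨δ, hδ, h⟩ := hexp ε hε
  refine ⟨δ, hδ, fun p q π π' hπ _ hp hq hclose => ?_⟩
  refine h p q (fun t => π' / π * t) (by fun_prop) (mul_zero _) fun t => ?_
  have hper : Function.Periodic (fun t => dist (φ t p) (φ (π' / π * t) q)) π := fun t => by
    have h₁ := hφ.periodic_orbit hp t
    have h₂ := hφ.periodic_orbit hq (π' / π * t)
    have h₃ : π' / π * (t + π) = π' / π * t + π' := by field_simp
    simp only [h₃] at h₁ h₂ ⊢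
    rw [h₁, h₂]
  obtain ⟨u, hu, htu⟩ := hper.exists_mem_Ico₀ hπ t
  exact htu.trans_le (hclose u (Set.Ico_subset_Icc_self hu))
end

section
/- Let M be a metric space, let φ be a continuous flow on M, and let δ > 0, T > 0. Let I ≥ 1 be a natural number, let x_0, x_1, …, x_I ∈ M, and let t_1, …, t_{I-1} be real numbers with t_n > 2T for all 1 ≤ n ≤ I−1. Set S_0 = 0 and S_n = t_1 + ⋯ + t_n for 1 ≤ n ≤ I−1. Assume that d(φ_t(x_0), φ_t(x_1)) < δ for all |t| ≤ T, and that for every 1 ≤ n ≤ I−1 and every |t| ≤ T one has d(φ_t(φ_{t_n}(x_n)), φ_t(x_{n+1})) < δ. Define ψ : ℝ → M by: ψ(t) = φ_t(x_0) for t < 0; ψ(t) = φ_{t−S_n}(x_{n+1}) for S_n ≤ t < S_{n+1} and 0 ≤ n ≤ I−2; and ψ(t) = φ_{t−S_{I−1}}(x_I) for t ≥ S_{I−1}. Then ψ is a (δ,T)-pseudo-orbit of φ. -/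
/-- `ψ` is a `(δ, T)`-pseudo-orbit of the flow `φ`. -/
def IsPseudoOrbit {M : Type*} [MetricSpace M] (φ : ℝ → M → M) (δ T : ℝ)
    (ψ : ℝ → M) : Prop :=
  ∀ τ t : ℝ, |t| ≤ T → dist (φ t (ψ τ)) (ψ (τ + t)) < δ

/-- Any real number lies beyond the first `m + 1` breakpoints `S 0, …, S m`, or before the first
one, or between two consecutive ones. -/
theorem le_or_exists_lt_breakpoint (S : ℕ → ℝ) (u : ℝ) (m : ℕ) :
    S m ≤ u ∨ ∃ k ≤ m, (k = 0 ∨ S (k - 1) ≤ u) ∧ u < S k := by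
  induction m with
  | zero =>
    rcases le_or_gt (S 0) u with h | h
    · exact Or.inl h
    · exact Or.inr ⟨0, le_rfl, Or.inl rfl, h⟩
  | succ m ih =>
    rcases ih with h | ⟨k, hk, h⟩
    · rcases le_or_gt (S (m + 1)) u with h' | h'
      · exact Or.inl h'
      · exact Or.inr ⟨m + 1, le_rfl, Or.inr h, h'⟩
    · exact Or.inr ⟨k, hk.trans m.le_succ, h⟩

/-- If successive orbits `φ (· - S (k - 1)) (x k)` are `δ`-close within time `T` of the breakpoint
`S k`, and breakpoints are more than `2 * T` apart, then any two of the orbits that are active at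
times within `T` of `w` are `δ`-close at time `w`. -/
theorem dist_orbit_lt_of_breakpoints {M : Type*} [PseudoMetricSpace M] {φ : ℝ → M → M} {δ T : ℝ}
    (hδ : 0 < δ) (hT : 0 < T) {N : ℕ} {x : ℕ → M} {S : ℕ → ℝ}
    (hgap : ∀ k < N, S k + 2 * T < S (k + 1))
    (hclose : ∀ k ≤ N, ∀ w : ℝ, |w - S k| ≤ T →
      dist (φ (w - S (k - 1)) (x k)) (φ (w - S k) (x (k + 1))) < δ)
    {j k : ℕ} (hjk : j ≤ k) (hk : k ≤ N + 1) {u v w : ℝ}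
    (hu : j = N + 1 ∨ u < S j) (hv : k = 0 ∨ S (k - 1) ≤ v)
    (hwu : |w - u| ≤ T) (hwv : |w - v| ≤ T) :
    dist (φ (w - S (j - 1)) (x j)) (φ (w - S (k - 1)) (x k)) < δ := by
  rcases hjk.eq_or_lt with rfl | hlt
  · simpa using hδ
  obtain ⟨k, rfl⟩ : ∃ i, k = i + 1 := ⟨k - 1, by omega⟩
  have hu' : u < S j := hu.resolve_left (by omega)
  have hv' : S k ≤ v := by simpa using hv
  rw [abs_le] at hwu hwv
  have hmono : ∀ i, j + 1 ≤ i → i ≤ N → S j + 2 * T < S i := by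
    intro i hi
    induction i, hi using Nat.le_induction with
    | base => exact fun h => hgap j (by omega)
    | succ i _ ih =>
      intro h
      linarith [ih (by omega), hgap i (by omega)]
  have hkj : k = j := by
    by_contra hne
    linarith [hmono k (by omega) (by omega)]
  subst hkj
  exact hclose k (by omega) w (abs_le.2 ⟨by linarith, by linarith⟩)

/-- Concatenating pieces of true orbits of `φ` along points `x 0, …, x I`, whose
orbits match `δ`-closely (over time windows of radius `T`) at the jump times
`S 1 < S 2 < ⋯ < S (I-1)` (with jump gaps `t n > 2T`), yields a `(δ, T)`-pseudo-orbit. -/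
theorem concatenation_is_pseudo_orbit
    {M : Type*} [MetricSpace M] (φ : ℝ → M → M) (hφ : IsFlow φ)
    (δ T : ℝ) (hδ : 0 < δ) (hT : 0 < T)
    (I : ℕ) (hI : 1 ≤ I) (x : ℕ → M) (t : ℕ → ℝ) (S : ℕ → ℝ)
    (ht : ∀ n : ℕ, 1 ≤ n → n + 1 ≤ I → 2 * T < t n)
    (hS0 : S 0 = 0)
    (hSsucc : ∀ n : ℕ, n + 2 ≤ I → S (n + 1) = S n + t (n + 1))
    (h0 : ∀ s : ℝ, |s| ≤ T → dist (φ s (x 0)) (φ s (x 1)) < δ)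
    (hjump : ∀ n : ℕ, 1 ≤ n → n + 1 ≤ I → ∀ s : ℝ, |s| ≤ T →
      dist (φ s (φ (t n) (x n))) (φ s (x (n + 1))) < δ)
    (ψ : ℝ → M)
    (hψneg : ∀ u : ℝ, u < 0 → ψ u = φ u (x 0))
    (hψmid : ∀ n : ℕ, n + 2 ≤ I → ∀ u : ℝ, S n ≤ u → u < S (n + 1) →
      ψ u = φ (u - S n) (x (n + 1)))
    (hψend : ∀ u : ℝ, S (I - 1) ≤ u → ψ u = φ (u - S (I - 1)) (x I)) :
    IsPseudoOrbit φ δ T ψ := by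
  obtain ⟨-, -, hadd⟩ := hφ
  obtain ⟨N, rfl⟩ : ∃ N, I = N + 1 := ⟨I - 1, by omega⟩
  have hgap : ∀ k < N, S k + 2 * T < S (k + 1) := fun k hk => by
    linarith [hSsucc k (by omega), ht (k + 1) (by omega) (by omega)]
  have hclose : ∀ k ≤ N, ∀ w : ℝ, |w - S k| ≤ T →
      dist (φ (w - S (k - 1)) (x k)) (φ (w - S k) (x (k + 1))) < δ := by
    rintro (_ | k) hk w hw
    · exact h0 _ hw
    · have h := hjump (k + 1) (by omega) (by omega) _ hw
      rw [← hadd, hSsucc k (by omega)] at h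
      rw [hSsucc k (by omega)]
      convert h using 3
      simp only [Nat.add_sub_cancel]
      ring
  have hpiece : ∀ u : ℝ, ∃ k ≤ N + 1, (k = 0 ∨ S (k - 1) ≤ u) ∧ (k = N + 1 ∨ u < S k) ∧
      ψ u = φ (u - S (k - 1)) (x k) := by
    intro u
    rcases le_or_exists_lt_breakpoint S u N with h | ⟨k, hk, hl, hr⟩
    · exact ⟨N + 1, le_rfl, Or.inr h, Or.inl rfl, hψend u h⟩
    · refine ⟨k, by omega, hl, Or.inr hr, ?_⟩
      rcases k with _ | k
      · simpa [hS0] using hψneg u (by rwa [hS0] at hr)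
      · exact hψmid k (by omega) u (by simpa using hl) hr
  intro τ s hs
  obtain ⟨j, hj, hjl, hjr, hψj⟩ := hpiece τ
  obtain ⟨k, hk, hkl, hkr, hψk⟩ := hpiece (τ + s)
  rw [hψj, hψk, ← hadd, show s + (τ - S (j - 1)) = τ + s - S (j - 1) by ring]
  have hτ : |τ + s - τ| ≤ T := by simpa using hs
  have hτs : |τ + s - (τ + s)| ≤ T := by simpa using hT.le
  rcases le_total j k with hjk | hkj
  · exact dist_orbit_lt_of_breakpoints hδ hT hgap hclose hjk hk hjr hkl hτ hτs
  · rw [dist_comm]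
    exact dist_orbit_lt_of_breakpoints hδ hT hgap hclose hkj hj hkr hjl hτs hτ
end
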